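/- Let V be a finite-dimensional real vector space, σ a convex polyhedral cone in V, W a linear subspace of V, σ_W the smallest face of σ containing W ∩ σ, and Ŵ := σ_W + W. Let P¹ : V → V/W and P : V → V/Ŵ denote the canonical projections. Then the smallest face of the cone P¹(σ) is Ŵ/W = P¹(Ŵ), and the cone P(σ) is strictly convex, i.e., P(σ) ∩ (−P(σ)) = {0}. -/

import Mathlib

open scoped Pointwise

/-- A (not necessarily strictly) convex cone, as a subset of a real vector space:
it contains `0` and is closed under addition and under scaling by nonnegative reals. -/
def IsConeSet {V : Type*} [AddCommGroup V] [Module ℝ V] (τ : Set V) : Prop :=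
  (0 : V) ∈ τ ∧ (∀ x ∈ τ, ∀ y ∈ τ, x + y ∈ τ) ∧ ∀ c : ℝ, 0 ≤ c → ∀ x ∈ τ, c • x ∈ τ

/-- `τ` is a face of the convex cone `σ`: a convex subcone such that whenever the sum of
two elements of `σ` lies in `τ`, both elements lie in `τ`. -/
def IsFaceOf {V : Type*} [AddCommGroup V] [Module ℝ V] (τ σ : Set V) : Prop :=
  IsConeSet τ ∧ τ ⊆ σ ∧ ∀ x ∈ σ, ∀ y ∈ σ, x + y ∈ τ → x ∈ τ ∧ y ∈ τ

/-- A convex polyhedral cone in a real vector space: the set of all nonnegative linear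
combinations of finitely many vectors. -/
def IsPolyCone {V : Type*} [AddCommGroup V] [Module ℝ V] (σ : Set V) : Prop :=
  ∃ (m : ℕ) (g : Fin m → V),
    σ = { x | ∃ c : Fin m → ℝ, (∀ k, 0 ≤ c k) ∧ x = ∑ k, c k • g k }

/-- The smallest face of the cone `σ` containing the subset `A ⊆ σ`. -/
def minFaceContaining {V : Type*} [AddCommGroup V] [Module ℝ V] (σ A : Set V) : Set V :=
  ⋂₀ { τ | IsFaceOf τ σ ∧ A ⊆ τ }

theorem IsPolyCone.isConeSet {V : Type*} [AddCommGroup V] [Module ℝ V] {σ : Set V}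
    (hσ : IsPolyCone σ) : IsConeSet σ := by
  obtain ⟨m, g, rfl⟩ := hσ
  refine ⟨⟨0, fun _ => le_rfl, by simp⟩, ?_, ?_⟩
  · rintro _ ⟨c, hc, rfl⟩ _ ⟨d, hd, rfl⟩
    exact ⟨c + d, fun k => add_nonneg (hc k) (hd k), by simp [add_smul, Finset.sum_add_distrib]⟩
  · rintro a ha _ ⟨c, hc, rfl⟩
    exact ⟨a • c, fun k => mul_nonneg ha (hc k), by simp [Finset.smul_sum, smul_smul]⟩

/-- The smallest face of `σ` containing `W ∩ σ` consists of the elements of `σ` that can be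
completed to an element of `W` by adding an element of `σ`. -/
theorem minFaceContaining_submodule_inter {V : Type*} [AddCommGroup V] [Module ℝ V]
    {σ : Set V} (hσ : IsConeSet σ) (W : Submodule ℝ V) :
    minFaceContaining σ ((W : Set V) ∩ σ) = { x | x ∈ σ ∧ ∃ u ∈ σ, x + u ∈ W } := by
  obtain ⟨h0, hadd, hsmul⟩ := hσ
  apply Set.Subset.antisymm
  · refine Set.sInter_subset_of_mem ⟨⟨⟨?_, ?_, ?_⟩, fun x hx => hx.1, ?_⟩, ?_⟩
    · exact ⟨h0, 0, h0, by simp⟩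
    · rintro x ⟨hx, u, hu, hxu⟩ y ⟨hy, v, hv, hyv⟩
      refine ⟨hadd x hx y hy, u + v, hadd u hu v hv, ?_⟩
      rw [add_add_add_comm]
      exact W.add_mem hxu hyv
    · rintro c hc x ⟨hx, u, hu, hxu⟩
      refine ⟨hsmul c hc x hx, c • u, hsmul c hc u hu, ?_⟩
      rw [← smul_add]
      exact W.smul_mem c hxu
    · rintro x hx y hy ⟨-, u, hu, hxyu⟩
      refine ⟨⟨hx, y + u, hadd y hy u hu, ?_⟩, ⟨hy, x + u, hadd x hx u hu, ?_⟩⟩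
      · rwa [← add_assoc]
      · rwa [← add_assoc, add_comm y x]
    · rintro x ⟨hxW, hx⟩
      exact ⟨hx, 0, h0, by simpa using hxW⟩
  · rintro x ⟨hx, u, hu, hxu⟩ τ ⟨⟨-, -, hτ⟩, hWτ⟩
    exact (hτ x hx u hu (hWτ ⟨hxu, hadd x hx u hu⟩)).1

/-- **Section 5.**  With `σ_W` the smallest face of `σ` containing `W ∩ σ` and
`Ŵ := σ_W + W`, the smallest face of the cone `P¹(σ)` is `Ŵ/W = P¹(Ŵ)`, and the cone
`P(σ)` is strictly convex, where `P¹ : V → V/W` and `P : V → V/Ŵ` are the projections. -/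
theorem smallest_face_of_projection_and_strict_convexity
    {V : Type*} [AddCommGroup V] [Module ℝ V] [FiniteDimensional ℝ V]
    (σ : Set V) (hσ : IsPolyCone σ) (W What : Submodule ℝ V)
    (hWhat : (What : Set V) = minFaceContaining σ ((W : Set V) ∩ σ) + (W : Set V)) :
    (W.mkQ '' σ) ∩ (-(W.mkQ '' σ)) = W.mkQ '' (What : Set V) ∧
      (What.mkQ '' σ) ∩ (-(What.mkQ '' σ)) = ({0} : Set (V ⧸ What)) := by
  have hcone := hσ.isConeSet
  rw [minFaceContaining_submodule_inter hcone W] at hWhat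
  obtain ⟨h0, hadd, -⟩ := hcone
  have mem_What : ∀ x, x ∈ What ↔ ∃ t ∈ { x | x ∈ σ ∧ ∃ u ∈ σ, x + u ∈ W }, ∃ w ∈ W,
      t + w = x := fun x => by
    rw [← SetLike.mem_coe, hWhat]
    exact Set.mem_add
  have mem_of_add_mem : ∀ x ∈ σ, ∀ u ∈ σ, x + u ∈ W → x ∈ What := fun x hx u hu h =>
    (mem_What x).2 ⟨x, ⟨hx, u, hu, h⟩, 0, W.zero_mem, add_zero x⟩
  constructor
  · ext q
    constructor
    · rintro ⟨⟨x, hx, rfl⟩, y, hy, hxy⟩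
      refine ⟨x, mem_of_add_mem x hx y hy ?_, rfl⟩
      rw [← W.ker_mkQ, LinearMap.mem_ker, map_add, hxy, add_neg_cancel]
    · rintro ⟨x, hx, rfl⟩
      obtain ⟨t, ⟨ht, u, hu, htu⟩, w, hw, rfl⟩ := (mem_What x).1 hx
      rw [← W.ker_mkQ, LinearMap.mem_ker] at htu hw
      rw [map_add] at htu
      rw [map_add, hw, add_zero]
      exact ⟨⟨t, ht, rfl⟩, u, hu, eq_neg_of_add_eq_zero_right htu⟩
  · apply Set.Subset.antisymm
    · rintro _ ⟨⟨x, hx, rfl⟩, y, hy, hxy⟩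
      have hmem : x + y ∈ What := by
        rw [← What.ker_mkQ, LinearMap.mem_ker, map_add, hxy, add_neg_cancel]
      obtain ⟨t, ⟨-, u, hu, htu⟩, w, hw, htw⟩ := (mem_What _).1 hmem
      have hxW : x + (y + u) ∈ W := by
        rw [← add_assoc, ← htw, add_right_comm]
        exact W.add_mem htu hw
      have hxWhat := mem_of_add_mem x hx (y + u) (hadd y hy u hu) hxW
      rwa [← What.ker_mkQ, LinearMap.mem_ker] at hxWhat
    · rintro _ rfl
      exact ⟨⟨0, h0, map_zero _⟩, 0, h0, by simp⟩
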